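/- Let n, r be natural numbers with r ≥ 1 and 2r ≤ n, and let α be a real symmetric n × n matrix. Then ∑ δ^{(j_1,…,j_{2r})}_{(i_1,…,i_{2r})} ∏_{s=1}^{r} (α ⊙ δ)^{i_{2s−1} i_{2s}}_{j_{2s−1} j_{2s}} = (4^r · (n − r)! · r! / (n − 2r)!) · σ_r(α), the sum running over all index tuples i_1,…,i_{2r}, j_1,…,j_{2r} ∈ Fin n. (This is the algebraic identity underlying the fact that on a locally conformally flat manifold, where the Riemann tensor equals the Kulkarni–Nomizu product of the Schouten tensor with the metric, the Gauss–Bonnet curvature G_{2r} equals 4^r (n−r)! r!/(n−2r)! times σ_r of the Schouten tensor.) -/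

import Mathlib

/-- The generalized Kronecker symbol `δ^{(j_1,…,j_m)}_{(i_1,…,i_m)}`:
the determinant of the `m × m` real matrix whose `(a, b)` entry is `1`
if `i a = j b` and `0` otherwise. -/
noncomputable def gKron {n m : ℕ} (i j : Fin m → Fin n) : ℝ :=
  Matrix.det (Matrix.of fun a b => if i a = j b then (1 : ℝ) else 0)

/-- The `r`-th elementary symmetric function of the (real) eigenvalues of a
real symmetric (Hermitian) `n × n` matrix `α`. -/
noncomputable def sigmaEig {n : ℕ} (α : Matrix (Fin n) (Fin n) ℝ)
    (hα : α.IsHermitian) (r : ℕ) : ℝ :=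
  ∑ t ∈ Finset.univ.powersetCard r, ∏ a ∈ t, hα.eigenvalues a

/-- The Kronecker delta `δ_{xy}`. -/
def kdelta {n : ℕ} (x y : Fin n) : ℝ := if x = y then 1 else 0

/-- The Kulkarni–Nomizu product of `α` with the identity:
`(α ⊙ δ)^{ab}_{cd} := α_{ac} δ_{bd} + α_{bd} δ_{ac} − α_{ad} δ_{bc} − α_{bc} δ_{ad}`. -/
def KN {n : ℕ} (α : Matrix (Fin n) (Fin n) ℝ) (a b c d : Fin n) : ℝ :=
  α a c * kdelta b d + α b d * kdelta a c - α a d * kdelta b c - α b c * kdelta a d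


theorem gb_perm2 (f : Equiv.Perm (Fin 2) → ℝ) :
    ∑ p, f p = f 1 + f (Equiv.swap 0 1) := by
  have : (Finset.univ : Finset (Equiv.Perm (Fin 2))) = {1, Equiv.swap 0 1} := by decide
  rw [this, Finset.sum_pair (by decide)]

theorem gb_KN {n : ℕ} (α : Matrix (Fin n) (Fin n) ℝ) (v w : Fin 2 → Fin n) :
    KN α (v 0) (v 1) (w 0) (w 1) = ∑ pq : Equiv.Perm (Fin 2) × Equiv.Perm (Fin 2),
      ((Equiv.Perm.sign pq.1 : ℤ) : ℝ) * ((Equiv.Perm.sign pq.2 : ℤ) : ℝ) *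
       (α (v (pq.1 0)) (w (pq.2 0)) * kdelta (v (pq.1 1)) (w (pq.2 1))) := by
  rw [Fintype.sum_prod_type, gb_perm2, gb_perm2, gb_perm2]
  simp [KN]
  ring

noncomputable def gbK {n : ℕ} {ι : Type} [Fintype ι] [DecidableEq ι] (i j : ι → Fin n) : ℝ :=
  Matrix.det (Matrix.of fun a b => if i a = j b then (1 : ℝ) else 0)

theorem gbK_perm {n : ℕ} {ι : Type} [Fintype ι] [DecidableEq ι] (i j : ι → Fin n)
    (p q : Equiv.Perm ι) :
    gbK (i ∘ p) (j ∘ q) = ((Equiv.Perm.sign p : ℤ) : ℝ) * ((Equiv.Perm.sign q : ℤ) : ℝ) * gbK i j := by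
  have := Matrix.det_permute p ((Matrix.of fun a b => if i a = j b then (1 : ℝ) else 0).submatrix id q)
  rw [Matrix.det_permute' q] at this
  unfold gbK
  rw [mul_assoc, ← this]
  rfl

theorem gb_step1 (n r : ℕ) (α : Matrix (Fin n) (Fin n) ℝ) :
    ∑ i : Fin (2 * r) → Fin n, ∑ j : Fin (2 * r) → Fin n,
        gKron i j *
          ∏ s : Fin r,
            KN α (i ⟨2 * s.val, by have := s.isLt; omega⟩)
                 (i ⟨2 * s.val + 1, by have := s.isLt; omega⟩)
                 (j ⟨2 * s.val, by have := s.isLt; omega⟩)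
                 (j ⟨2 * s.val + 1, by have := s.isLt; omega⟩)
    = ∑ i : Fin r × Fin 2 → Fin n, ∑ j : Fin r × Fin 2 → Fin n,
       gbK i j * ∏ s : Fin r, KN α (i (s,0)) (i (s,1)) (j (s,0)) (j (s,1)) := by
  let e : Fin r × Fin 2 ≃ Fin (2 * r) := finProdFinEquiv.trans (finCongr (mul_comm _ _))
  have e0 : ∀ s : Fin r, e (s, 0) = ⟨2 * s.val, by have := s.isLt; omega⟩ := by
    intro s; ext; simp [e]
  have e1 : ∀ s : Fin r, e (s, 1) = ⟨2 * s.val + 1, by have := s.isLt; omega⟩ := by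
    intro s; ext; simp [e]; ring
  refine Fintype.sum_equiv (e.symm.arrowCongr (Equiv.refl _)) _ _ fun i => ?_
  refine Fintype.sum_equiv (e.symm.arrowCongr (Equiv.refl _)) _ _ fun j => ?_
  congr 1
  · unfold gKron gbK
    rw [← Matrix.det_submatrix_equiv_self e]
    rfl
  · refine Finset.prod_congr rfl fun s _ => ?_
    simp [Equiv.arrowCongr, e0, e1]

theorem gb_step2 (n r : ℕ) (α : Matrix (Fin n) (Fin n) ℝ) :
    ∑ i : Fin r × Fin 2 → Fin n, ∑ j : Fin r × Fin 2 → Fin n,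
       gbK i j * ∏ s : Fin r, KN α (i (s,0)) (i (s,1)) (j (s,0)) (j (s,1))
    = 4 ^ r * ∑ i : Fin r × Fin 2 → Fin n, ∑ j : Fin r × Fin 2 → Fin n,
       gbK i j * ∏ s : Fin r, (α (i (s,0)) (j (s,0)) * kdelta (i (s,1)) (j (s,1))) := by
  have h : ∀ i j : Fin r × Fin 2 → Fin n, gbK i j * ∏ s : Fin r, KN α (i (s,0)) (i (s,1)) (j (s,0)) (j (s,1))
     = ∑ P : Fin r → Equiv.Perm (Fin 2) × Equiv.Perm (Fin 2),
        gbK (i ∘ Equiv.prodCongrRight fun s => (P s).1) (j ∘ Equiv.prodCongrRight fun s => (P s).2) *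
        ∏ s : Fin r, (α (i (s,(P s).1 0)) (j (s,(P s).2 0)) * kdelta (i (s,(P s).1 1)) (j (s,(P s).2 1))) := by
    intro i j
    have this := fun s => gb_KN α (fun t => i (s,t)) (fun t => j (s,t))
    rw [Finset.prod_congr rfl fun s _ => this s]
    rw [Finset.prod_univ_sum, Fintype.piFinset_univ, Finset.mul_sum]
    refine Finset.sum_congr rfl fun P _ => ?_
    have h1 := Equiv.Perm.sign_prodCongrRight fun s => (P s).1
    have h2 := Equiv.Perm.sign_prodCongrRight fun s => (P s).2
    rw [gbK_perm]
    erw [h1, h2]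
    rw [Finset.prod_mul_distrib, Finset.prod_mul_distrib]
    push_cast
    ring
  simp only [h]
  have h3 : ∀ i : Fin r × Fin 2 → Fin n, ∀ F : (Fin r × Fin 2 → Fin n) → (Fin r → Equiv.Perm (Fin 2) × Equiv.Perm (Fin 2)) → ℝ, ∑ j, ∑ P, F j P = ∑ P, ∑ j, F j P :=
    fun i F => Finset.sum_comm
  rw [Finset.sum_congr rfl fun i _ => h3 i _, Finset.sum_comm]
  have h4 : (4:ℝ)^r = ∑ P : Fin r → Equiv.Perm (Fin 2) × Equiv.Perm (Fin 2), (1:ℝ) := by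
    simp [Fintype.card_perm]
  rw [h4, Finset.sum_mul]
  refine Finset.sum_congr rfl fun P _ => ?_
  rw [one_mul]
  refine Fintype.sum_equiv ((Equiv.prodCongrRight fun s => (P s).1).symm.arrowCongr (Equiv.refl _)) _ _ fun i => ?_
  refine Fintype.sum_equiv ((Equiv.prodCongrRight fun s => (P s).2).symm.arrowCongr (Equiv.refl _)) _ _ fun j => ?_
  rfl

theorem gbK_expand {n : ℕ} {ι : Type} [Fintype ι] [DecidableEq ι] (B : ι → Matrix (Fin n) (Fin n) ℝ) :
    ∑ i : ι → Fin n, ∑ j : ι → Fin n, gbK i j * ∏ a, B a (i a) (j a)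
    = ∑ p : Equiv.Perm ι, ((Equiv.Perm.sign p : ℤ) : ℝ) * ∑ i : ι → Fin n, ∏ a, B a (i a) (i (p a)) := by
  simp only [Finset.mul_sum]
  rw [Finset.sum_comm (s := (Finset.univ : Finset (Equiv.Perm ι)))]
  refine Finset.sum_congr rfl fun i _ => ?_
  simp only [gbK, Matrix.det_apply', Finset.sum_mul]
  rw [Finset.sum_comm]
  refine Finset.sum_congr rfl fun p _ => ?_
  rw [Finset.sum_eq_single (fun a => i (p a))]
  · simp
  · intro j _ hj
    obtain ⟨a, ha⟩ := Function.ne_iff.1 hj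
    rw [Finset.prod_eq_zero (i := a) (Finset.mem_univ _)]
    · simp
    · simp [Ne.symm ha]
  · simp

theorem gb_cyc {n : ℕ} {ι : Type} [Fintype ι] [DecidableEq ι] (A : ι → Matrix (Fin n) (Fin n) ℝ)
    (V : Matrix (Fin n) (Fin n) ℝ) (p : Equiv.Perm ι) :
    ∑ i : ι → Fin n, ∏ a, (A a * V) (i a) (i (p a)) =
    ∑ i : ι → Fin n, ∏ a, (V * A (p a)) (i a) (i (p a)) := by
  have h1 : ∀ i : ι → Fin n, ∏ a, (A a * V) (i a) (i (p a)) =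
     ∑ k : ι → Fin n, (∏ a, A a (i a) (k a)) * ∏ a, V (k a) (i (p a)) := by
    intro i
    simp only [Matrix.mul_apply, Finset.prod_univ_sum, Fintype.piFinset_univ, Finset.prod_mul_distrib]
  have h2 : ∀ i : ι → Fin n, ∏ a, (V * A (p a)) (i a) (i (p a)) =
     ∑ k : ι → Fin n, (∏ a, V (i a) (k a)) * ∏ a, A (p a) (k a) (i (p a)) := by
    intro i
    simp only [Matrix.mul_apply, Finset.prod_univ_sum, Fintype.piFinset_univ, Finset.prod_mul_distrib]
  simp only [h1, h2]
  rw [Finset.sum_comm]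
  refine Finset.sum_congr rfl fun k _ => ?_
  refine Fintype.sum_equiv (p.symm.arrowCongr (Equiv.refl _)) _ _ fun i => ?_
  rw [mul_comm]
  congr 1
  exact (Equiv.prod_comp p (fun a => A a (i a) (k a))).symm

theorem gb_diag {n : ℕ} {ι : Type} [Fintype ι] [DecidableEq ι] (B : ι → Matrix (Fin n) (Fin n) ℝ)
    (U W : Matrix (Fin n) (Fin n) ℝ) (h : W * U = 1) (d : ι → Fin n → ℝ)
    (hB : ∀ a, B a = U * Matrix.diagonal (d a) * W) :
    ∑ i : ι → Fin n, ∑ j : ι → Fin n, gbK i j * ∏ a, B a (i a) (j a)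
    = ∑ k : ι → Fin n, gbK k k * ∏ a, d a (k a) := by
  rw [gbK_expand]
  have h1 : ∀ p : Equiv.Perm ι, ∑ i : ι → Fin n, ∏ a, B a (i a) (i (p a)) =
      ∑ k : ι → Fin n, (∏ a, if k (p a) = k a then (1 : ℝ) else 0) * ∏ a, d a (k a) := by
    intro p
    simp only [hB]
    rw [gb_cyc]
    refine Finset.sum_congr rfl fun k _ => ?_
    rw [← Equiv.prod_comp p (fun a => d a (k a)), ← Finset.prod_mul_distrib]
    refine Finset.prod_congr rfl fun a _ => ?_
    rw [← mul_assoc, h, one_mul, Matrix.diagonal_apply]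
    by_cases hk : k a = k (p a)
    · simp [hk]
    · simp [hk, Ne.symm hk]
  simp only [h1, Finset.mul_sum]
  rw [Finset.sum_comm]
  refine Finset.sum_congr rfl fun k _ => ?_
  simp only [gbK, Matrix.det_apply', Finset.sum_mul, Matrix.of_apply, mul_assoc]

theorem gbK_self {n : ℕ} {ι : Type} [Fintype ι] [DecidableEq ι] (k : ι → Fin n) [Decidable (Function.Injective k)] :
    gbK k k = if Function.Injective k then 1 else 0 := by
  split_ifs with h
  · unfold gbK
    rw [← Matrix.det_one (n := ι)]
    congr 1
    ext a b
    simp [Matrix.one_apply, h.eq_iff]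
  · simp only [Function.Injective, not_forall] at h
    obtain ⟨a, b, h1, h2⟩ := h
    exact Matrix.det_zero_of_row_eq h2 (by ext c; simp [h1])

theorem gb_inj {n : ℕ} {ι : Type} [Fintype ι] [DecidableEq ι] (f : (ι → Fin n) → ℝ) :
    ∑ k : ι → Fin n, gbK k k * f k = ∑ k : ι ↪ Fin n, f k := by
  classical
  simp only [gbK_self, ite_mul, one_mul, zero_mul]
  rw [← Finset.sum_filter]
  symm
  refine Finset.sum_bij (fun k _ => (k : ι → Fin n)) ?_ ?_ ?_ ?_
  · intro k _; simp [k.injective]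
  · intro a _ b _ h; exact DFunLike.coe_injective h
  · intro b hb; exact ⟨⟨b, (Finset.mem_filter.1 hb).2⟩, Finset.mem_univ _, rfl⟩
  · intros; rfl

theorem gb_esymm {n : ℕ} (r : ℕ) (d : Fin n → ℝ) :
    ∑ k : Fin r ↪ Fin n, ∏ s, d (k s) = r.factorial * ∑ t ∈ Finset.univ.powersetCard r, ∏ a ∈ t, d a := by
  classical
  rw [← Finset.sum_fiberwise_of_maps_to (s := Finset.univ) (t := Finset.univ.powersetCard r)
    (g := fun k : Fin r ↪ Fin n => Finset.univ.map k) (by intro k _; simp [Finset.mem_powersetCard])]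
  rw [Finset.mul_sum]
  refine Finset.sum_congr rfl fun t ht => ?_
  have h1 : ∀ k ∈ Finset.univ.filter (fun k : Fin r ↪ Fin n => Finset.univ.map k = t), ∏ s, d (k s) = ∏ a ∈ t, d a := by
    intro k hk
    rw [← (Finset.mem_filter.1 hk).2, Finset.prod_map]
  rw [Finset.sum_congr rfl h1, Finset.sum_const, nsmul_eq_mul]
  congr 2
  have hc : t.card = r := (Finset.mem_powersetCard.1 ht).2
  let e : Fin r ≃ t := (t.equivFinOfCardEq hc).symm
  have : (Finset.univ : Finset (Equiv.Perm (Fin r))).card = r.factorial := by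
    simp [Finset.card_univ, Fintype.card_perm]
  rw [← this]
  symm
  refine Finset.card_bij (fun p _ => (p.trans e).toEmbedding.trans (Function.Embedding.subtype _)) ?_ ?_ ?_
  · intro p _
    simp only [Finset.mem_filter, Finset.mem_univ, true_and]
    apply Finset.eq_of_subset_of_card_le
    · intro x hx
      simp only [Finset.mem_map, Finset.mem_univ, true_and] at hx
      obtain ⟨a, rfl⟩ := hx
      simp
    · simp [hc]
  · intro p _ q _ h
    ext a
    have := DFunLike.congr_fun h a
    simp at this
    rw [this]
  · intro k hk
    have hk := (Finset.mem_filter.1 hk).2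
    have hm : ∀ a, k a ∈ t := by intro a; rw [← hk]; simp
    have hinj : Function.Injective (fun a => e.symm ⟨k a, hm a⟩) := by
      intro a b h
      simpa using h
    refine ⟨Equiv.ofBijective _ (Finite.injective_iff_bijective.1 hinj), Finset.mem_univ _, ?_⟩
    ext a
    simp

theorem gb_count {n r : ℕ} (hrn : 2 * r ≤ n) (d : Fin n → ℝ) :
    ∑ k : Fin r × Fin 2 ↪ Fin n, ∏ s, d (k (s, 0)) =
    ((n - r).factorial / (n - 2 * r).factorial : ℝ) * ∑ k : Fin r ↪ Fin n, ∏ s, d (k s) := by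
  classical
  let e : Fin r × Fin 2 ≃ Fin r ⊕ Fin r :=
    (Equiv.prodComm _ _).trans ((finTwoEquiv.prodCongr (Equiv.refl _)).trans (Equiv.boolProdEquivSum _))
  have he : ∀ s, e (s, 0) = Sum.inl s := by intro s; rfl
  have h1 : ∑ k : Fin r × Fin 2 ↪ Fin n, ∏ s, d (k (s, 0)) =
     ∑ k : Fin r ⊕ Fin r ↪ Fin n, ∏ s, d (k (Sum.inl s)) := by
    refine Fintype.sum_equiv (e.embeddingCongr (Equiv.refl _)) _ _ fun k => ?_
    refine Finset.prod_congr rfl fun s _ => ?_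
    rw [← he]
    simp
  rw [h1]
  have h2 : ∑ k : Fin r ⊕ Fin r ↪ Fin n, ∏ s, d (k (Sum.inl s)) =
    ∑ k : (Σ f : Fin r ↪ Fin n, Fin r ↪ ↥(Set.range f)ᶜ), ∏ s, d (k.1 s) := by
    refine Fintype.sum_equiv Equiv.sumEmbeddingEquivSigmaEmbeddingRestricted _ _ fun k => ?_
    rfl
  rw [h2, Fintype.sum_sigma, Finset.mul_sum]
  refine Finset.sum_congr rfl fun k _ => ?_
  simp only [Finset.sum_const, nsmul_eq_mul]
  congr 1
  rw [Finset.card_univ, Fintype.card_embedding_eq, Fintype.card_fin, Fintype.card_compl_set,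
    Fintype.card_range, Fintype.card_fin, Fintype.card_fin, eq_div_iff (by positivity)]
  have := Nat.factorial_mul_descFactorial (n := n - r) (k := r) (by omega)
  rw [show n - r - r = n - 2 * r by omega] at this
  rw [mul_comm]
  exact_mod_cast this

theorem gb_S (n r : ℕ) (hrn : 2 * r ≤ n) (α : Matrix (Fin n) (Fin n) ℝ) (hα : α.IsHermitian) :
    ∑ i : Fin r × Fin 2 → Fin n, ∑ j : Fin r × Fin 2 → Fin n,
       gbK i j * ∏ s : Fin r, (α (i (s,0)) (j (s,0)) * kdelta (i (s,1)) (j (s,1)))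
    = ((n - r).factorial / (n - 2 * r).factorial : ℝ) * (r.factorial * sigmaEig α hα r) := by
  have hU : (star (hα.eigenvectorUnitary : Matrix (Fin n) (Fin n) ℝ)) * (hα.eigenvectorUnitary : Matrix (Fin n) (Fin n) ℝ) = 1 :=
    Unitary.coe_star_mul_self _
  have hU' : (hα.eigenvectorUnitary : Matrix (Fin n) (Fin n) ℝ) * (star (hα.eigenvectorUnitary : Matrix (Fin n) (Fin n) ℝ)) = 1 :=
    Unitary.coe_mul_star_self _
  have hs := hα.spectral_theorem
  rw [Unitary.conjStarAlgAut_apply] at hs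
  have := gb_diag (ι := Fin r × Fin 2) (fun a => if a.2 = 0 then α else 1) _ _ hU
    (fun a => if a.2 = 0 then hα.eigenvalues else 1) (by
      intro a
      by_cases h : a.2 = 0
      · simp only [h, if_true]; exact hs
      · simp only [h, if_false]
        rw [show Matrix.diagonal (1 : Fin n → ℝ) = 1 from Matrix.diagonal_one, mul_one, hU'])
  simp only [Fintype.prod_prod_type, Fin.prod_univ_two] at this
  simp only [if_true, Fin.isValue, one_ne_zero, if_false, Matrix.one_apply, Pi.one_apply, mul_one] at this
  unfold kdelta
  rw [this, gb_inj, gb_count hrn, gb_esymm]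
  rfl

/-- The `2r`-fold contraction of the generalized Kronecker symbol against `r` copies of
the Kulkarni–Nomizu product `α ⊙ δ` equals `4^r (n−r)! r!/(n−2r)!` times `σ_r(α)`. -/
theorem gauss_bonnet_lcf (n r : ℕ) (hr : 1 ≤ r) (hrn : 2 * r ≤ n)
    (α : Matrix (Fin n) (Fin n) ℝ) (hα : α.IsHermitian) :
    ∑ i : Fin (2 * r) → Fin n, ∑ j : Fin (2 * r) → Fin n,
        gKron i j *
          ∏ s : Fin r,
            KN α (i ⟨2 * s.val, by have := s.isLt; omega⟩)
                 (i ⟨2 * s.val + 1, by have := s.isLt; omega⟩)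
                 (j ⟨2 * s.val, by have := s.isLt; omega⟩)
                 (j ⟨2 * s.val + 1, by have := s.isLt; omega⟩)
      = ((4 : ℝ) ^ r * (Nat.factorial (n - r)) * (Nat.factorial r) /
          (Nat.factorial (n - 2 * r))) * sigmaEig α hα r := by
  rw [gb_step1, gb_step2, gb_S n r hrn α hα]
  ring
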